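/- arXiv:2107.06156 — 4 statements merged into one kernel-verified Lean document; each statement's English description precedes it below -/
import Mathlib

section
/- There exist constants c > 0 and N ∈ ℕ such that for every n ≥ N the value of the n-fold parallel repetition of the GHZ game is at most n^{−c}. Explicitly: for every strategy f1,f2,f3 : F_2^n → F_2^n, the fraction of pairs (x,y) ∈ F_2^n × F_2^n such that for every coordinate i ∈ {1,...,n} one has f1(x)_i + f2(y)_i + f3(x+y)_i = x_i ∨ y_i ∨ (x+y)_i is at most n^{−c}. -/
/-- Vectors of length `n` over `F_2`. -/
abbrev Vec (n : ℕ) := Fin n → ZMod 2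

/-- Boolean OR of three bits: `0` iff all three bits are `0`. -/
def or3 (u v w : ZMod 2) : ZMod 2 := if u = 0 ∧ v = 0 ∧ w = 0 then 0 else 1

/-- The players win coordinate `i` on query `(x, y, x+y)` with strategy `f1, f2, f3`. -/
def winCoord {n : ℕ} (f1 f2 f3 : Vec n → Vec n) (x y : Vec n) (i : Fin n) : Prop :=
  f1 x i + f2 y i + f3 (x + y) i = or3 (x i) (y i) ((x + y) i)

instance {n : ℕ} (f1 f2 f3 : Vec n → Vec n) (x y : Vec n) (i : Fin n) :
    Decidable (winCoord f1 f2 f3 x y i) :=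
  inferInstanceAs (Decidable (_ = _))

open scoped Pointwise

/-- In a dense bipartite graph there is a large set `S` of vertices on one side any two of which
are joined by many paths of length four. -/
theorem exists_large_subset_many_paths {α β : Type*} [Fintype α] [Fintype β] (r : α → β → Prop)
    [DecidableRel r] {N ε : ℝ} (hα : (Fintype.card α : ℝ) = N) (hβ : (Fintype.card β : ℝ) = N)
    (hN : 0 < N) (hε : 0 < ε)
    (hr : ε * N ^ 2 ≤ ∑ b, ((Finset.univ.filter fun a ↦ r a b).card : ℝ)) :
    ∃ S : Finset α, ε * N / 4 ≤ S.card ∧ ∀ s ∈ S, ∀ t ∈ S, ∃ U : Finset α,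
      ε * N / 4 ≤ U.card ∧ ∀ u ∈ U,
        ε ^ 2 * N / 16 ≤ (Finset.univ.filter fun b ↦ r s b ∧ r u b).card ∧
        ε ^ 2 * N / 16 ≤ (Finset.univ.filter fun b ↦ r u b ∧ r t b).card := by
  classical
  set nb : β → Finset α := fun b ↦ Finset.univ.filter fun a ↦ r a b with hnb
  set co : α → α → ℝ := fun a a' ↦ (Finset.univ.filter fun b ↦ r a b ∧ r a' b).card with hco
  have co_comm (a a') : co a a' = co a' a := by simp only [hco, and_comm]
  set bad : β → Finset (α × α) := fun b ↦
    (nb b ×ˢ nb b).filter fun p ↦ co p.1 p.2 < ε ^ 2 * N / 16 with hbad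
  have hsq : ε ^ 2 * N ^ 3 ≤ ∑ b, ((nb b).card : ℝ) ^ 2 := by
    have h := sq_sum_le_card_mul_sum_sq (s := (Finset.univ : Finset β))
      (f := fun b ↦ ((nb b).card : ℝ))
    rw [Finset.card_univ, hβ] at h
    have h2 : (ε * N ^ 2) ^ 2 ≤ (∑ b, ((nb b).card : ℝ)) ^ 2 := by gcongr
    refine le_of_mul_le_mul_left (a := N) ?_ hN
    nlinarith
  have hbadsum : ∑ b, ((bad b).card : ℝ) ≤ N ^ 2 * (ε ^ 2 * N / 16) := by
    have h1 : ∑ b, ((bad b).card : ℝ) =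
        ∑ p : α × α, if co p.1 p.2 < ε ^ 2 * N / 16 then co p.1 p.2 else 0 := by
      have h2 (b : β) : ((bad b).card : ℝ) = ∑ p : α × α,
          if co p.1 p.2 < ε ^ 2 * N / 16 then (if r p.1 b ∧ r p.2 b then (1 : ℝ) else 0) else 0 := by
        have : bad b = Finset.univ.filter
            fun p : α × α ↦ co p.1 p.2 < ε ^ 2 * N / 16 ∧ r p.1 b ∧ r p.2 b := by
          ext p; simp [hbad, hnb, and_comm]
        rw [this, Finset.card_filter]
        push_cast
        refine Finset.sum_congr rfl fun p _ ↦ ?_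
        rw [ite_and]
      simp_rw [h2]
      rw [Finset.sum_comm]
      refine Finset.sum_congr rfl fun p _ ↦ ?_
      split_ifs
      · simp [hco]
      · simp
    rw [h1]
    calc _ ≤ ∑ p : α × α, ε ^ 2 * N / 16 := by
          refine Finset.sum_le_sum fun p _ ↦ ?_
          split_ifs with h
          · exact h.le
          · positivity
      _ = _ := by
          rw [Finset.sum_const, Finset.card_univ, Fintype.card_prod, nsmul_eq_mul]
          push_cast
          rw [hα]
          ring
  obtain ⟨b, hb⟩ : ∃ b, ε ^ 2 * N ^ 2 / 2 ≤ ((nb b).card : ℝ) ^ 2 - 8 * (bad b).card := by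
    by_contra! h
    have h1 : ∑ b, (((nb b).card : ℝ) ^ 2 - 8 * (bad b).card) < ∑ _b : β, ε ^ 2 * N ^ 2 / 2 := by
      refine Finset.sum_lt_sum_of_nonempty ?_ fun b _ ↦ h b
      rw [← Finset.card_pos, Finset.card_univ]
      exact_mod_cast hβ ▸ hN
    rw [Finset.sum_sub_distrib, ← Finset.mul_sum, Finset.sum_const, Finset.card_univ,
      nsmul_eq_mul, hβ] at h1
    nlinarith
  set m : ℝ := ((nb b).card : ℝ) with hm
  have hm0 : 0 ≤ m := by positivity
  have hmε : ε * N / 2 ≤ m := by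
    refine le_of_sq_le_sq ?_ hm0
    have : (0 : ℝ) ≤ (bad b).card := by positivity
    nlinarith [sq_nonneg (ε * N)]
  have hmpos : 0 < m := lt_of_lt_of_le (by positivity) hmε
  have hbm : 8 * ((bad b).card : ℝ) ≤ m ^ 2 := by nlinarith [sq_nonneg (ε * N)]
  set badAt : α → Finset α := fun a ↦ (nb b).filter fun u ↦ co a u < ε ^ 2 * N / 16 with hbadAt
  have hbadcard : ((bad b).card : ℝ) = ∑ a ∈ nb b, ((badAt a).card : ℝ) := by
    rw [hbad]
    simp only [hbadAt, Finset.card_filter, Finset.sum_product]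
    push_cast
    rfl
  refine ⟨(nb b).filter fun a ↦ ((badAt a).card : ℝ) ≤ m / 4, ?_, ?_⟩
  · set T := (nb b).filter fun a ↦ ¬ ((badAt a).card : ℝ) ≤ m / 4 with hT
    have hsplit : (((nb b).filter fun a ↦ ((badAt a).card : ℝ) ≤ m / 4).card : ℝ) + T.card = m := by
      rw [hm, hT]
      exact_mod_cast Finset.card_filter_add_card_filter_not (s := nb b) _
    have hTm : (T.card : ℝ) * (m / 4) ≤ (bad b).card := by
      rw [hbadcard, ← nsmul_eq_mul]
      refine (Finset.card_nsmul_le_sum T (fun a ↦ ((badAt a).card : ℝ)) _ fun a ha ↦ ?_).trans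
        (Finset.sum_le_sum_of_subset_of_nonneg (Finset.filter_subset _ _)
          fun _ _ _ ↦ by positivity)
      exact (not_le.1 (Finset.mem_filter.1 ha).2).le
    have : (T.card : ℝ) ≤ m / 2 := by
      refine le_of_mul_le_mul_right ?_ hmpos
      nlinarith
    linarith
  · intro s hs t ht
    have hs' := (Finset.mem_filter.1 hs).2
    have ht' := (Finset.mem_filter.1 ht).2
    refine ⟨nb b \ (badAt s ∪ badAt t), ?_, ?_⟩
    · have h1 : ((badAt s ∪ badAt t).card : ℝ) ≤ (badAt s).card + (badAt t).card := by
        exact_mod_cast Finset.card_union_le _ _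
      have h2 : m ≤ (nb b \ (badAt s ∪ badAt t)).card + ((badAt s ∪ badAt t).card : ℝ) := by
        rw [hm]
        exact_mod_cast tsub_le_iff_right.1 (Finset.le_card_sdiff (badAt s ∪ badAt t) (nb b))
      linarith
    · intro u hu
      simp only [hbadAt, Finset.mem_sdiff, Finset.mem_union, Finset.mem_filter, not_or,
        not_and, not_lt] at hu
      refine ⟨hu.2.1 hu.1, ?_⟩
      have := hu.2.2 hu.1
      rwa [co_comm] at this

/-- If `F x + G y + H (x + y) = 0` for many pairs `(x, y)`, then `F` maps some large set onto a set
with small difference set. -/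
theorem exists_large_subset_card_sub_le {V M : Type*} [Fintype V] [AddCommGroup V]
    [AddCommGroup M] [DecidableEq M] (F G H : V → M) {N ε : ℝ} (hV : (Fintype.card V : ℝ) = N)
    (hN : 0 < N) (hε : 0 < ε)
    (hE : ε * N ^ 2 ≤
      (Finset.univ.filter fun p : V × V ↦ F p.1 + G p.2 + H (p.1 + p.2) = 0).card) :
    ∃ S : Finset V, ε * N / 4 ≤ S.card ∧
      ((S.image F - S.image F).card : ℝ) * ε ^ 5 ≤ 1024 * N := by
  classical
  obtain ⟨S, hS, hpath⟩ := exists_large_subset_many_paths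
    (fun x y : V ↦ F x + G y + H (x + y) = 0) hV hV hN hε (hE.trans_eq (by
      simp only [Finset.card_filter, Fintype.sum_prod_type_right]
      push_cast
      rfl))
  refine ⟨S, hS, ?_⟩
  set φ : V × V × V × V → M := fun c ↦ -H c.1 + H c.2.1 - H c.2.2.1 + H c.2.2.2 with hφ
  have hfib : ∀ d ∈ S.image F - S.image F,
      ε * N / 4 * (ε ^ 2 * N / 16 * (ε ^ 2 * N / 16)) ≤
        ((Finset.univ.filter fun c ↦ φ c = d).card : ℝ) := by
    intro d hd
    obtain ⟨_, hs', _, ht', rfl⟩ := Finset.mem_sub.1 hd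
    obtain ⟨s, hs, rfl⟩ := Finset.mem_image.1 hs'
    obtain ⟨t, ht, rfl⟩ := Finset.mem_image.1 ht'
    obtain ⟨U, hU, hUst⟩ := hpath s hs t ht
    set P : V → V → Finset V := fun a a' ↦ Finset.univ.filter
      fun b ↦ F a + G b + H (a + b) = 0 ∧ F a' + G b + H (a' + b) = 0 with hP
    have hcard : ((U.sigma fun u ↦ P s u ×ˢ P u t).card : ℝ) ≤
        (Finset.univ.filter fun c ↦ φ c = F s - F t).card := by
      refine mod_cast Finset.card_le_card_of_injOn
        (fun q ↦ (s + q.2.1, q.1 + q.2.1, q.1 + q.2.2, t + q.2.2)) ?_ ?_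
      · rintro ⟨u, b, b'⟩ hq
        simp only [hP, Finset.coe_sigma, Set.mem_sigma_iff, Finset.mem_coe, Finset.mem_product,
          Finset.mem_filter, Finset.mem_univ, true_and] at hq
        obtain ⟨-, ⟨h1, h2⟩, h3, h4⟩ := hq
        simp only [hφ, Finset.coe_filter, Finset.mem_univ, true_and, Set.mem_ofPred_eq]
        rw [← neg_eq_iff_add_eq_zero.2 h1, ← neg_eq_iff_add_eq_zero.2 h2,
          ← neg_eq_iff_add_eq_zero.2 h3, ← neg_eq_iff_add_eq_zero.2 h4]
        abel
      · rintro ⟨u, b, b'⟩ - ⟨u', c, c'⟩ - h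
        simp only [Prod.mk.injEq, add_right_inj] at h
        obtain ⟨rfl, h2, -, rfl⟩ := h
        obtain rfl := add_right_cancel h2
        rfl
    refine le_trans ?_ hcard
    rw [Finset.card_sigma]
    push_cast
    calc _ ≤ (U.card : ℝ) * (ε ^ 2 * N / 16 * (ε ^ 2 * N / 16)) := by gcongr
      _ ≤ _ := by
        rw [← nsmul_eq_mul]
        refine Finset.card_nsmul_le_sum _ _ _ fun u hu ↦ ?_
        rw [Finset.card_product]
        push_cast
        exact mul_le_mul (hUst u hu).1 (hUst u hu).2 (by positivity) (by positivity)
  have htotal := Finset.card_nsmul_le_sum _ _ _ hfib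
  have hle : ∑ d ∈ S.image F - S.image F, ((Finset.univ.filter fun c ↦ φ c = d).card : ℝ) ≤
      N ^ 4 := by
    have h := Finset.card_le_univ (Finset.univ.filter fun c ↦ φ c ∈ S.image F - S.image F)
    rw [← Finset.sum_card_fiberwise_eq_card_filter] at h
    have h' := (Nat.cast_le (α := ℝ)).2 h
    simp only [Fintype.card_prod] at h'
    push_cast at h'
    rw [hV] at h'
    exact h'.trans_eq (by ring)
  rw [nsmul_eq_mul] at htotal
  have h := htotal.trans hle
  refine le_of_mul_le_mul_right ?_ (pow_pos hN 3)
  nlinarith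

/-- The representative in `{0, 1} ⊆ ZMod 4` of a bit. -/
def bitLift (u : ZMod 2) : ZMod 4 := if u = 0 then 0 else 1

/-- The function `2 f(x) - x` over `ZMod 4`, which turns the GHZ winning condition into a linear
equation. -/
def liftStrategy {n : ℕ} (f : Vec n → Vec n) (x : Vec n) : Fin n → ZMod 4 :=
  fun i ↦ 2 * bitLift (f x i) - bitLift (x i)

theorem liftStrategy_add_eq_zero {n : ℕ} {f1 f2 f3 : Vec n → Vec n} {x y : Vec n}
    (h : ∀ i, winCoord f1 f2 f3 x y i) :
    liftStrategy f1 x + liftStrategy f2 y + liftStrategy f3 (x + y) = 0 := by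
  have key : ∀ a b c u v : ZMod 2, a + b + c = or3 u v (u + v) →
      2 * bitLift a - bitLift u + (2 * bitLift b - bitLift v) +
        (2 * bitLift c - bitLift (u + v)) = 0 := by
    unfold or3 bitLift; decide
  funext i
  exact key _ _ _ _ _ (h i)

theorem eq_and_eq_of_liftStrategy_add_eq {n : ℕ} {f : Vec n → Vec n} {x y x' y' : Vec n}
    (h : liftStrategy f x + (liftStrategy f y + liftStrategy f y) =
      liftStrategy f x' + (liftStrategy f y' + liftStrategy f y')) : x = x' ∧ y = y' := by
  have hdouble : ∀ b v : ZMod 2,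
      2 * bitLift b - bitLift v + (2 * bitLift b - bitLift v) = 2 * bitLift v := by
    unfold bitLift; decide
  have hfirst : ∀ u a u' a' v v' : ZMod 2, 2 * bitLift a - bitLift u + 2 * bitLift v =
      2 * bitLift a' - bitLift u' + 2 * bitLift v' → u = u' := by
    unfold bitLift; decide
  have hsecond : ∀ v v' : ZMod 2, 2 * bitLift v = 2 * bitLift v' → v = v' := by
    unfold bitLift; decide
  have hi (i) : 2 * bitLift (f x i) - bitLift (x i) + 2 * bitLift (y i) =
      2 * bitLift (f x' i) - bitLift (x' i) + 2 * bitLift (y' i) := by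
    have := congrFun h i
    simpa only [liftStrategy, Pi.add_apply, hdouble] using this
  obtain rfl : x = x' := funext fun i ↦ hfirst _ _ _ _ _ _ (hi i)
  exact ⟨rfl, funext fun i ↦ hsecond _ _ (add_left_cancel (hi i))⟩

theorem liftStrategy_injective {n : ℕ} (f : Vec n → Vec n) :
    Function.Injective (liftStrategy f) := fun x x' h ↦
  (eq_and_eq_of_liftStrategy_add_eq (f := f) (y := 0) (y' := 0) (by rw [h])).1

theorem sq_card_le_card_three_nsmul {n : ℕ} (f : Vec n → Vec n) (S : Finset (Vec n)) :
    S.card ^ 2 ≤ (3 • S.image (liftStrategy f)).card := by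
  rw [sq, ← Finset.card_product]
  refine Finset.card_le_card_of_injOn
    (fun p ↦ liftStrategy f p.1 + (liftStrategy f p.2 + liftStrategy f p.2)) ?_ ?_
  · rintro ⟨x, y⟩ hp
    obtain ⟨hx, hy⟩ := Finset.mem_product.1 hp
    have hx' := Finset.mem_image_of_mem (liftStrategy f) hx
    have hy' := Finset.mem_image_of_mem (liftStrategy f) hy
    rw [show 3 • S.image (liftStrategy f) = S.image (liftStrategy f) +
      (S.image (liftStrategy f) + S.image (liftStrategy f)) by
        rw [succ_nsmul', two_nsmul]]
    exact Finset.add_mem_add hx' (Finset.add_mem_add hy' hy')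
  · rintro ⟨x, y⟩ - ⟨x', y'⟩ - h
    obtain ⟨rfl, rfl⟩ := eq_and_eq_of_liftStrategy_add_eq h
    rfl

/-- The winning probability `ε` decays exponentially: `ε ^ 19 * 2 ^ n ≤ 2 ^ 38`. -/
theorem pow_mul_two_pow_le_of_le_card_win {n : ℕ} (f1 f2 f3 : Vec n → Vec n) {ε : ℝ} (hε : 0 < ε)
    (h : ε * 2 ^ (2 * n) ≤ (Finset.univ.filter (fun p : Vec n × Vec n =>
            ∀ i : Fin n, winCoord f1 f2 f3 p.1 p.2 i)).card) :
    ε ^ 19 * 2 ^ n ≤ 2 ^ 38 := by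
  set N : ℝ := 2 ^ n with hNdef
  have hN : 0 < N := by positivity
  obtain ⟨S, hS, hD⟩ := exists_large_subset_card_sub_le (liftStrategy f1) (liftStrategy f2)
    (liftStrategy f3) (N := N) (by simp [hNdef]) hN hε (by
      rw [hNdef, ← pow_mul, mul_comm n 2]
      refine h.trans ?_
      exact_mod_cast Finset.card_le_card fun p hp ↦ by
        simp only [Finset.mem_filter, Finset.mem_univ, true_and] at hp ⊢
        exact liftStrategy_add_eq_zero hp)
  set A := S.image (liftStrategy f1) with hA
  have hAS : A.card = S.card := Finset.card_image_of_injective _ (liftStrategy_injective f1)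
  have hSpos : (0 : ℝ) < S.card := lt_of_lt_of_le (by positivity) hS
  have hAne : A.Nonempty := by
    rw [← Finset.card_pos, hAS]
    exact_mod_cast hSpos
  have hplu := Finset.pluennecke_ruzsa_inequality_nsmul_sub hAne A 3
  have hplu' : ((3 • A).card : ℝ) ≤ ((A - A).card / A.card : ℝ) ^ 3 * A.card := by
    have h := (NNRat.cast_le (K := ℝ)).2 hplu
    push_cast at h
    exact h
  have hsq : (S.card : ℝ) ^ 2 ≤ (3 • A).card := by
    exact_mod_cast sq_card_le_card_three_nsmul f1 S
  rw [hAS] at hplu'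
  set s : ℝ := (S.card : ℝ)
  set d : ℝ := ((A - A).card : ℝ)
  have h4 : s ^ 4 ≤ d ^ 3 := by
    have := hsq.trans hplu'
    have h2 : (d / s) ^ 3 * s = d ^ 3 / s ^ 2 := by field_simp
    rw [h2, le_div_iff₀ (by positivity)] at this
    linarith
  have h5 : (ε * N / 4) ^ 4 ≤ s ^ 4 := by gcongr
  have h6 : (d * ε ^ 5) ^ 3 ≤ (1024 * N) ^ 3 := by gcongr
  refine le_of_mul_le_mul_right ?_ (pow_pos hN 3)
  calc ε ^ 19 * N * N ^ 3 = 256 * ((ε * N / 4) ^ 4 * ε ^ 15) := by ring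
    _ ≤ 256 * (d ^ 3 * ε ^ 15) := by gcongr; exact h5.trans h4
    _ = 256 * (d * ε ^ 5) ^ 3 := by ring
    _ ≤ 256 * (1024 * N) ^ 3 := by gcongr
    _ = 2 ^ 38 * N ^ 3 := by ring

/-- The value of the `n`-fold parallel repetition of the GHZ game is at most `n ^ (-c)`. -/
theorem ghz_parallel_repetition_polynomial :
    ∃ c : ℝ, 0 < c ∧ ∃ N : ℕ, ∀ n : ℕ, N ≤ n →
      ∀ f1 f2 f3 : Vec n → Vec n,
        ((Finset.univ.filter (fun p : Vec n × Vec n =>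
            ∀ i : Fin n, winCoord f1 f2 f3 p.1 p.2 i)).card : ℝ) / (2 : ℝ) ^ (2 * n)
          ≤ (n : ℝ) ^ (-c) := by
  have hlim := (tendsto_pow_const_div_const_pow_of_one_lt 19
    (one_lt_two : (1 : ℝ) < 2)).eventually_lt_const (show (0 : ℝ) < (2 ^ 38)⁻¹ by positivity)
  obtain ⟨N, hN⟩ := Filter.eventually_atTop.1 hlim
  refine ⟨1, one_pos, max N 1, fun n hn f1 f2 f3 ↦ ?_⟩
  have hn0 : (0 : ℝ) < n := by exact_mod_cast le_of_max_le_right hn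
  rw [Real.rpow_neg_one]
  by_contra! hlt
  rw [lt_div_iff₀ (by positivity)] at hlt
  have h := pow_mul_two_pow_le_of_le_card_win f1 f2 f3 (inv_pos.2 hn0) hlt.le
  have hsmall := hN n (le_of_max_le_left hn)
  rw [div_lt_iff₀ (by positivity), inv_mul_eq_div, lt_div_iff₀ (by positivity)] at hsmall
  rw [inv_pow, inv_mul_eq_div, div_le_iff₀ (by positivity)] at h
  linarith
end

section
/- (Bow ties embed the GHZ game) Let n ∈ ℕ, i ∈ {1,...,n}, and x0,x1,y0,y1 ∈ F_2^n with x0+y0 = x1+y1 and x0(i) ≠ x1(i). Then for every triple of functions f1,f2,f3 : F_2^n → F_2^n, the number of pairs (a,b) ∈ {0,1}^2 such that, writing x = x_a, y = y_b, z = x_a + y_b, one has f1(x)_i + f2(y)_i + f3(z)_i = x_i ∨ y_i ∨ z_i, is at most 3. (Equivalently, the value in coordinate i of the n-fold GHZ game under the uniform distribution on the four triples (x_a, y_b, x_a+y_b) is at most 3/4.) -/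
/-- On the four queries of a bow tie in `F_2`, the target bits `or3` sum to `1`. -/
theorem or3_bowtie_sum (u u' v v' : ZMod 2) (h : u + v = u' + v') (hu : u ≠ u') :
    or3 u v (u + v) + or3 u v' (u + v') + or3 u' v (u' + v) + or3 u' v' (u' + v') = 1 := by
  revert u u' v v'
  unfold or3
  decide

/-- Bow ties embed the GHZ game: if `x0 + y0 = x1 + y1` and `x0(i) ≠ x1(i)`, then for any
strategy `f1, f2, f3`, the players win coordinate `i` on at most `3` of the `4` queries
`(x_a, y_b, x_a + y_b)`, `(a, b) ∈ {0,1}²`. -/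
theorem bowtie_embeds_ghz {n : ℕ} (i : Fin n) (x0 x1 y0 y1 : Vec n)
    (hbt : x0 + y0 = x1 + y1) (hdiff : x0 i ≠ x1 i)
    (f1 f2 f3 : Vec n → Vec n) :
    (Finset.univ.filter (fun ab : Fin 2 × Fin 2 =>
        let x := if ab.1 = 0 then x0 else x1
        let y := if ab.2 = 0 then y0 else y1
        f1 x i + f2 y i + f3 (x + y) i = or3 (x i) (y i) ((x + y) i))).card ≤ 3 := by
  have hcross : x1 + y0 = x0 + y1 := by
    ext j
    have hj := congrFun hbt j
    simp only [Pi.add_apply] at hj ⊢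
    generalize x0 j = a, x1 j = b, y0 j = c, y1 j = d at hj ⊢
    revert a b c d
    decide
  by_contra! hcard
  have huniv := (Finset.card_eq_iff_eq_univ _).mp
    (le_antisymm (Finset.card_le_univ _)
      (show Fintype.card (Fin 2 × Fin 2) ≤ _ from hcard))
  simp only [Finset.filter_eq_self, Finset.mem_univ, true_imp_iff] at huniv
  have h00 := huniv (0, 0)
  have h01 := huniv (0, 1)
  have h10 := huniv (1, 0)
  have h11 := huniv (1, 1)
  simp only [if_true, one_ne_zero, if_false] at h00 h01 h10 h11
  have hsum := or3_bowtie_sum (x0 i) (x1 i) (y0 i) (y1 i) (congrFun hbt i) hdiff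
  simp only [← Pi.add_apply] at hsum
  rw [← h00, ← h01, ← h10, ← h11, hcross, hbt] at hsum
  generalize f1 x0 i = a, f1 x1 i = b, f2 y0 i = c, f2 y1 i = d,
    f3 (x1 + y1) i = e, f3 (x0 + y1) i = g at hsum
  revert a b c d e g
  decide
end

section
/- (Near-uniformity criterion) Let m ∈ ℕ with m ≥ 1 and let ṽ ∈ ℝ^m be a vector with nonnegative entries such that ‖ṽ‖₁ = 1 and ‖ṽ‖₂ = (1+β)/√m for some β ∈ [0,1]. Let ũ = (1/m, ..., 1/m) ∈ ℝ^m. Then ‖ṽ − ũ‖₁ ≤ √(3β). -/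
/-- Near-uniformity criterion: if `ṽ ∈ ℝ^m` has nonnegative entries, `‖ṽ‖₁ = 1` and
`‖ṽ‖₂ = (1 + β)/√m` with `β ∈ [0, 1]`, then `‖ṽ − ũ‖₁ ≤ √(3β)` where `ũ` is the
uniform vector `(1/m, ..., 1/m)`. -/
theorem near_uniformity_criterion (m : ℕ) (hm : 1 ≤ m) (v : Fin m → ℝ)
    (hv : ∀ i, 0 ≤ v i) (β : ℝ) (hβ0 : 0 ≤ β) (hβ1 : β ≤ 1)
    (hl1 : ∑ i, |v i| = 1)
    (hl2 : Real.sqrt (∑ i, (v i) ^ 2) = (1 + β) / Real.sqrt m) :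
    ∑ i, |v i - 1 / (m : ℝ)| ≤ Real.sqrt (3 * β) := by
  have hm0 : (0 : ℝ) < m := by exact_mod_cast hm
  have hsum : ∑ i, v i = 1 := by
    rw [← hl1]
    exact Finset.sum_congr rfl fun i _ => (abs_of_nonneg (hv i)).symm
  have hsq : ∑ i, (v i) ^ 2 = (1 + β) ^ 2 / m := by
    rw [← Real.sq_sqrt (Finset.sum_nonneg fun i _ => sq_nonneg (v i)), hl2, div_pow,
      Real.sq_sqrt hm0.le]
  have hdev : ∑ i, (v i - 1 / (m : ℝ)) ^ 2 = (2 * β + β ^ 2) / m := by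
    simp only [sub_sq, Finset.sum_add_distrib, Finset.sum_sub_distrib, ← Finset.sum_mul,
      ← Finset.mul_sum, hsum, hsq, Finset.sum_const, Finset.card_univ, Fintype.card_fin,
      nsmul_eq_mul]
    field_simp
    ring
  apply Real.le_sqrt_of_sq_le
  calc (∑ i, |v i - 1 / (m : ℝ)|) ^ 2 ≤ m * ∑ i, |v i - 1 / (m : ℝ)| ^ 2 := by
        simpa using sq_sum_le_card_mul_sum_sq (s := Finset.univ)
          (f := fun i => |v i - 1 / (m : ℝ)|)
    _ = 2 * β + β ^ 2 := by
        simp only [sq_abs, hdev]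
        field_simp
    _ ≤ 3 * β := by nlinarith
end

section
/- (Value of the GHZ game) The value of the GHZ game is 3/4. Explicitly: (a) for every triple of functions f1,f2,f3 : F_2 → F_2, the number of pairs (a,b) ∈ F_2 × F_2 such that f1(a) + f2(b) + f3(a+b) = a ∨ b ∨ (a+b) is at most 3; and (b) there exists a triple f1,f2,f3 : F_2 → F_2 for which this number equals 3. -/
/-- The value of the GHZ game is `3/4`: every strategy wins on at most `3` of the `4`
queries `(a, b, a+b)`, and some strategy wins on exactly `3` of them. -/
theorem ghz_value_three_quarters :
    (∀ f1 f2 f3 : ZMod 2 → ZMod 2,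
      (Finset.univ.filter (fun p : ZMod 2 × ZMod 2 =>
        f1 p.1 + f2 p.2 + f3 (p.1 + p.2) = or3 p.1 p.2 (p.1 + p.2))).card ≤ 3) ∧
    (∃ f1 f2 f3 : ZMod 2 → ZMod 2,
      (Finset.univ.filter (fun p : ZMod 2 × ZMod 2 =>
        f1 p.1 + f2 p.2 + f3 (p.1 + p.2) = or3 p.1 p.2 (p.1 + p.2))).card = 3) := by
  refine ⟨fun f1 f2 f3 => ?_, fun _ => 1, fun _ => 0, fun _ => 0, by decide⟩
  by_contra h
  have hwin : ∀ p : ZMod 2 × ZMod 2,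
      f1 p.1 + f2 p.2 + f3 (p.1 + p.2) = or3 p.1 p.2 (p.1 + p.2) := by
    have hcard : Fintype.card (ZMod 2 × ZMod 2) = 4 := by decide
    have huniv := Finset.eq_univ_of_card _
      (le_antisymm (Finset.card_le_univ _) (hcard.trans_le (not_le.mp h)))
    exact fun p => (Finset.mem_filter_univ p).mp (huniv ▸ Finset.mem_univ p)
  -- Each answer occurs twice among the four winning equations, whose right sides sum to `1`.
  have hsum : ∀ x₀ x₁ y₀ y₁ z₀ z₁ : ZMod 2, x₀ + y₀ + z₀ = 0 → x₀ + y₁ + z₁ = 1 →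
      x₁ + y₀ + z₁ = 1 → x₁ + y₁ + z₀ ≠ 1 := by decide
  exact hsum _ _ _ _ _ _ (hwin (0, 0)) (hwin (0, 1)) (hwin (1, 0)) (hwin (1, 1))
end
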